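/- arXiv:2006.05126 — 2 statements merged into one kernel-verified Lean document; each statement's English description precedes it below -/
import Mathlib

section
/- Let α > 0 and a > 0, let t₀ ∈ ℝ, and let r : [t₀, ∞) → ℝ be differentiable and satisfy ṙ(t) = −α·r(t)·(r(t) − a) for all t ≥ t₀, with initial condition r(t₀) ≥ a/2. Then for all t ≥ t₀ one has r(t) ≥ a/2 and |r(t) − a| ≤ |r(t₀) − a| · exp(−(α·a/2)·(t − t₀)). In particular the circle r = a is invariant (if r(t₀) = a then r(t) = a for all t ≥ t₀) and attracts all such solutions exponentially. -/
/-- For the unforced radial equation `ṙ = −α r (r − a)` with `α, a > 0`, any solution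
starting with `r(t₀) ≥ a/2` stays `≥ a/2` and converges exponentially to the invariant
circle `r = a`: `|r(t) − a| ≤ |r(t₀) − a| exp(−(αa/2)(t − t₀))` for all `t ≥ t₀`. -/
theorem radial_equation_exponential_attraction
    (α a : ℝ) (hα : 0 < α) (ha : 0 < a) (t₀ : ℝ) (r : ℝ → ℝ)
    (hderiv : ∀ t ≥ t₀, HasDerivAt r (-α * r t * (r t - a)) t)
    (h₀ : r t₀ ≥ a / 2) :
    (∀ t ≥ t₀, r t ≥ a / 2
      ∧ |r t - a| ≤ |r t₀ - a| * Real.exp (-(α * a / 2) * (t - t₀)))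
    ∧ (r t₀ = a → ∀ t ≥ t₀, r t = a) := by
  have hlow : ∀ t ≥ t₀, r t ≥ a / 2 := by
    intro t ht
    have h := image_le_of_deriv_right_lt_deriv_boundary (f := fun t => -r t)
      (f' := fun t => -(-α * r t * (r t - a))) (a := t₀) (b := t)
      (B := fun _ => -(a / 2)) (B' := fun _ => 0)
      (fun x hx => (hderiv x hx.1).neg.continuousAt.continuousWithinAt)
      (fun x hx => (hderiv x hx.1).neg.hasDerivWithinAt)
      (by simpa using h₀) (fun x => hasDerivAt_const x _)
      (by
        intro x hx h
        have h2 : r x = a / 2 := by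
          have : -r x = -(a / 2) := h
          linarith
        simp only [h2]
        have : 0 < α * a * a := by positivity
        nlinarith)
      (show t ∈ Set.Icc t₀ t from ⟨ht, le_rfl⟩)
    have h' : -r t ≤ -(a / 2) := h
    linarith
  have hexp : ∀ t ≥ t₀, |r t - a| ≤ |r t₀ - a| * Real.exp (-(α * a / 2) * (t - t₀)) := by
    intro t ht
    have hd : ∀ x ≥ t₀, HasDerivAt (fun t => ((r t - a) * Real.exp ((α * a / 2) * (t - t₀))) ^ 2)
        (-(2 * α * (r x - a / 2) * ((r x - a) * Real.exp ((α * a / 2) * (x - t₀))) ^ 2)) x := by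
      intro x hx
      have h1 : HasDerivAt (fun t => (α * a / 2) * (t - t₀)) ((α * a / 2) * 1) x :=
        ((hasDerivAt_id x).sub_const t₀).const_mul _
      have h2 := (((hderiv x hx).sub_const a).mul h1.exp).pow 2
      refine h2.congr_deriv ?_
      simp only [Pi.mul_apply]
      push_cast
      ring
    have h := image_le_of_deriv_right_le_deriv_boundary (a := t₀) (b := t)
      (B := fun _ => (r t₀ - a) ^ 2) (B' := fun _ => 0)
      (fun x hx => (hd x hx.1).continuousAt.continuousWithinAt)
      (fun x hx => (hd x hx.1).hasDerivWithinAt)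
      (by simp) continuousOn_const (fun x _ => (hasDerivAt_const x _).hasDerivWithinAt)
      (by
        intro x hx
        have h1 : 0 ≤ r x - a / 2 := by linarith [hlow x hx.1]
        have : 0 ≤ 2 * α * (r x - a / 2) *
          ((r x - a) * Real.exp ((α * a / 2) * (x - t₀))) ^ 2 := by positivity
        linarith)
      (show t ∈ Set.Icc t₀ t from ⟨ht, le_rfl⟩)
    have h' := sq_le_sq.mp h
    rw [abs_mul, Real.abs_exp] at h'
    rw [neg_mul, Real.exp_neg, ← div_eq_mul_inv, le_div_iff₀ (Real.exp_pos _)]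
    exact h'
  refine ⟨fun t ht => ⟨hlow t ht, hexp t ht⟩, fun h t ht => ?_⟩
  have h1 := hexp t ht
  rw [h, sub_self, abs_zero, zero_mul] at h1
  linarith [abs_nonpos_iff.mp h1]
end

section
/- Let f(s) = sin(2πs) + sin(4s) for s ∈ ℝ. Then the supremum over s ∈ ℝ of f(s) equals 2, and this supremum is not attained: f(s) < 2 for every s ∈ ℝ, yet for every ε > 0 there exists s with f(s) > 2 − ε. -/
lemma forcing_lt (s : ℝ) : Real.sin (2 * Real.pi * s) + Real.sin (4 * s) < 2 := by
  by_contra! h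
  have h1 := Real.sin_le_one (2 * Real.pi * s)
  have h2 := Real.sin_le_one (4 * s)
  have h3 : Real.sin (2 * Real.pi * s) = 1 := by linarith
  have h4 : Real.sin (4 * s) = 1 := by linarith
  rw [Real.sin_eq_one_iff] at h3 h4
  obtain ⟨k, hk⟩ := h3
  obtain ⟨m, hm⟩ := h4
  have hs : s = 1 / 4 + k := by
    have := Real.pi_ne_zero
    have h5 : Real.pi * (s - (1 / 4 + k)) = 0 := by linarith
    have := (mul_eq_zero.mp h5).resolve_left this
    linarith
  have h0 : (1 + 4 * m : ℝ) ≠ 0 := by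
    have : (1 + 4 * m : ℤ) ≠ 0 := by omega
    exact_mod_cast this
  apply irrational_pi
  refine ⟨((2 + 8 * k : ℤ) : ℚ) / ((1 + 4 * m : ℤ) : ℚ), ?_⟩
  push_cast
  rw [div_eq_iff h0]
  rw [hs] at hm
  linarith

lemma forcing_near (ε : ℝ) (hε : ε > 0) :
    ∃ s : ℝ, Real.sin (2 * Real.pi * s) + Real.sin (4 * s) > 2 - ε := by
  have hirr : Irrational (4 / (2 * Real.pi)) := by
    rintro ⟨q, hq⟩
    apply irrational_pi
    refine ⟨2 / q, ?_⟩
    push_cast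
    rw [hq]
    have := Real.pi_ne_zero
    field_simp
    try norm_num
  have hd := dense_addSubgroupClosure_pair_iff.mpr hirr
  have ho : IsOpen {x : ℝ | 1 - ε < Real.sin (1 + x)} :=
    isOpen_lt (by fun_prop) (by fun_prop)
  obtain ⟨x, hx, hxc⟩ := hd.inter_open_nonempty _ ho
    ⟨Real.pi / 2 - 1, by simp [hε]⟩
  obtain ⟨n, k, rfl⟩ := AddSubgroup.mem_closure_pair.mp hxc
  refine ⟨1 / 4 + n, ?_⟩
  have e1 : Real.sin (2 * Real.pi * (1 / 4 + n)) = 1 :=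
    Real.sin_eq_one_iff.mpr ⟨n, by ring⟩
  have e2 : Real.sin (1 + (n • (4 : ℝ) + k • (2 * Real.pi))) = Real.sin (4 * (1 / 4 + n)) := by
    rw [← Real.sin_add_int_mul_two_pi (4 * (1 / 4 + n)) k]
    congr 1
    simp only [zsmul_eq_mul]
    ring
  have hx' : 1 - ε < Real.sin (1 + (n • (4 : ℝ) + k • (2 * Real.pi))) := hx
  rw [e2] at hx'
  linarith



/-- For the quasiperiodic forcing `f(s) = sin(2πs) + sin(4s)`, the supremum over
`s ∈ ℝ` equals `2`, it is never attained (`f(s) < 2` for all `s`), and values arbitrarily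
close to `2` occur. -/
theorem forcing_sup_eq_two_not_attained :
    (⨆ s : ℝ, (Real.sin (2 * Real.pi * s) + Real.sin (4 * s))) = 2
    ∧ (∀ s : ℝ, Real.sin (2 * Real.pi * s) + Real.sin (4 * s) < 2)
    ∧ (∀ ε > 0, ∃ s : ℝ, Real.sin (2 * Real.pi * s) + Real.sin (4 * s) > 2 - ε) := by
  refine ⟨?_, forcing_lt, forcing_near⟩
  apply ciSup_eq_of_forall_le_of_forall_lt_exists_gt
  · exact fun s => (forcing_lt s).le
  · intro w hw
    obtain ⟨s, hs⟩ := forcing_near (2 - w) (by linarith)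
    exact ⟨s, by linarith⟩
end
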